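/- Under the LOB pricing structure, Assumption 2, Assumptions 1(3)-1(4) on a continuously differentiable haircut function g, and assuming every bank is fundamentally solvent (h_i ≤ a_i·f̄_i(a_1,...,a_n) for all i), if −nM·min((n/2)f'(0), g'(0)) < min_j min_{s ∈ D} (f̄_j(s) − g(Σ_{i=1}^n s_i)), then there exists exactly one clearing price vector (q*, q̄_1*,...,q̄_n*). -/

import Mathlib

noncomputable section

/-- The domain `D = ∏ [0, aᵢ]` of admissible liquidation vectors. -/
def memD (n : ℕ) (a s : Fin n → ℝ) : Prop := ∀ i, s i ∈ Set.Icc 0 (a i)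

/-- Bank `i`'s cost: realized loss from sales plus interest on the borrowed amount. -/
def obj (n : ℕ) (r : ℝ) (h : Fin n → ℝ) (fbar : Fin n → (Fin n → ℝ) → ℝ)
    (i : Fin n) (s : Fin n → ℝ) : ℝ :=
  s i * (1 - fbar i s) + r * (h i - s i * fbar i s)

/-- Feasibility in problem (P2) with fixed prices `(q, q̄)`. -/
def feasP2 (n : ℕ) (a h : Fin n → ℝ) (q : ℝ) (qb : Fin n → ℝ) (i : Fin n) (x : ℝ) : Prop :=
  x ∈ Set.Icc 0 (a i) ∧ x ≤ h i / qb i ∧ (h i - a i * q) / (qb i - q) ≤ x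

/-- `s` is a Nash equilibrium of problem (P2) at fixed prices `(q, q̄)`. -/
def NashP2 (n : ℕ) (a h : Fin n → ℝ) (r q : ℝ) (qb : Fin n → ℝ)
    (fbar : Fin n → (Fin n → ℝ) → ℝ) (s : Fin n → ℝ) : Prop :=
  ∀ i : Fin n,
    (h i ≤ a i * qb i →
      feasP2 n a h q qb i (s i) ∧
      ∀ x : ℝ, feasP2 n a h q qb i x →
        obj n r h fbar i s ≤ obj n r h fbar i (Function.update s i x)) ∧
    (a i * qb i < h i → s i = a i)

/-- Limit order book based price: all banks submit orders at the same rate, so when bank `i`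
has sold `u` units the total volume sold is `∑ⱼ min(sⱼ, u)`.  The average price obtained by
bank `i` is `(1/sᵢ) ∫₀^{sᵢ} f(∑ⱼ min(sⱼ,u)) du`, which coincides with the order-statistics
formula of the LOB pricing scheme. -/
def lob (n : ℕ) (f : ℝ → ℝ) : Fin n → (Fin n → ℝ) → ℝ := fun i s =>
  if s i = 0 then 1 else (∫ u in (0:ℝ)..(s i), f (∑ j, min (s j) u)) / s i

/-- Assumption 2 on the order book density `f : [0,M] → (0,1]`. -/
structure Assumption2 (M : ℝ) (f : ℝ → ℝ) : Prop where
  mem : ∀ x ∈ Set.Icc (0 : ℝ) M, f x ∈ Set.Ioc (0 : ℝ) 1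
  anti : StrictAntiOn f (Set.Icc 0 M)
  smooth : ContDiffOn ℝ 2 f (Set.Icc 0 M)
  f_zero : f 0 = 1
  deriv_mono : MonotoneOn (derivWithin f (Set.Icc 0 M)) (Set.Icc 0 M)

/-- `(q, q̄)` is a clearing price vector under LOB pricing. -/
def ClearingLOB (n : ℕ) (a h : Fin n → ℝ) (r : ℝ) (f g : ℝ → ℝ)
    (q : ℝ) (qb : Fin n → ℝ) : Prop :=
  ∃ s : Fin n → ℝ, memD n a s ∧ NashP2 n a h r q qb (lob n f) s ∧
    q = g (∑ i, s i) ∧ ∀ i, qb i = lob n f i s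


def ClampEq (n : ℕ) (c : ℝ) (lo up s : Fin n → ℝ) : Prop :=
  ∀ i, lo i ≤ s i ∧ s i ≤ up i ∧ (lo i < s i → ∑ j, min (s j) (s i) ≤ c) ∧
    (s i < up i → c ≤ ∑ j, min (s j) (s i))

theorem clamp_exists (n : ℕ) (c : ℝ) (lo up : Fin n → ℝ) (hc : 0 ≤ c)
    (h0 : ∀ i, 0 ≤ lo i) (hlu : ∀ i, lo i ≤ up i) : ∃ s, ClampEq n c lo up s := by
  by_cases hs : ∑ j, up j ≤ c
  · refine ⟨up, fun i => ⟨hlu i, le_rfl, fun _ => ?_, fun hh => absurd hh (lt_irrefl _)⟩⟩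
    exact (Finset.sum_le_sum fun j _ => min_le_left _ _).trans hs
  · push Not at hs
    have hup0 : ∀ i, 0 ≤ up i := fun i => (h0 i).trans (hlu i)
    have hS : 0 ≤ ∑ j, up j := Finset.sum_nonneg fun i _ => hup0 i
    have hcont : Continuous (fun t : ℝ => ∑ j, min (up j) t) := by fun_prop
    have := intermediate_value_Icc hS hcont.continuousOn
    have hmem : c ∈ Set.Icc (∑ j, min (up j) 0) (∑ j, min (up j) (∑ k, up k)) := by
      constructor
      · refine le_trans (Finset.sum_nonpos fun j _ => min_le_right _ _) hc
      · refine hs.le.trans (Finset.sum_le_sum fun j _ => le_min le_rfl ?_)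
        exact Finset.single_le_sum (fun i _ => hup0 i) (Finset.mem_univ j)
    obtain ⟨T, _, hT⟩ := this hmem
    simp only at hT
    have key : ∑ j, min (max (lo j) (min (up j) T)) T = c := by
      rw [← hT]
      refine Finset.sum_congr rfl fun j _ => ?_
      have := hlu j
      rcases le_total (up j) T with h1 | h1
      · rw [min_eq_left h1, max_eq_right this, min_eq_left h1]
      · rw [min_eq_right h1, min_eq_right (le_max_right _ _)]
    refine ⟨fun i => max (lo i) (min (up i) T), fun i => ⟨le_max_left _ _,
      max_le (hlu i) (min_le_left _ _), fun h1 => ?_, fun h1 => ?_⟩⟩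
    · rw [← key]
      refine Finset.sum_le_sum fun j _ => min_le_min le_rfl ?_
      rcases lt_max_iff.1 h1 with h2 | h2
      · exact absurd h2 (lt_irrefl _)
      · exact max_le (h2.le.trans (min_le_right _ _)) (min_le_right _ _)
    · conv_lhs => rw [← key]
      refine Finset.sum_le_sum fun j _ => min_le_min le_rfl ?_
      have h2 : min (up i) T < up i := (le_max_right _ _).trans_lt h1
      have h3 : T < up i := by
        by_contra h4
        rw [min_eq_left (not_lt.1 h4)] at h2
        exact lt_irrefl _ h2
      show T ≤ max (lo i) (min (up i) T)
      rw [min_eq_right h3.le]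
      exact le_max_right _ _

theorem clamp_lip_aux (n : ℕ) (c : ℝ) (lo up lo' up' s s' E : Fin n → ℝ)
    (hs : ClampEq n c lo up s) (hs' : ClampEq n c lo' up' s')
    (hlo : ∀ i, |lo i - lo' i| ≤ E i) (hup : ∀ i, |up i - up' i| ≤ E i) (i : Fin n) :
    s' i - s i ≤ ∑ j, E j := by
  have hE : ∀ j, 0 ≤ E j := fun j => (abs_nonneg _).trans (hlo j)
  have hEi : E i ≤ ∑ j, E j := Finset.single_le_sum (fun i _ => hE i) (Finset.mem_univ i)
  have hES : 0 ≤ ∑ j, E j := Finset.sum_nonneg fun i _ => hE i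
  obtain ⟨h1, h2, h3, h4⟩ := hs i
  obtain ⟨h1', h2', h3', h4'⟩ := hs' i
  have hloi := abs_le.1 (hlo i)
  have hupi := abs_le.1 (hup i)
  by_cases hlt : s i < s' i
  swap
  · linarith
  by_cases hA : s i < up i
  swap
  · linarith
  by_cases hB : lo' i < s' i
  swap
  · linarith
  have hN := (h3' hB).trans (h4 hA)
  have term : ∀ j ∈ Finset.univ.erase i, -E j ≤ min (s' j) (s' i) - min (s j) (s i) := by
    intro j hj
    have hEj := hE j
    obtain ⟨g1, g2, g3, g4⟩ := hs j
    obtain ⟨g1', g2', g3', g4'⟩ := hs' j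
    have hupj := abs_le.1 (hup j)
    by_cases hc1 : s i ≤ s' j
    · have : s i ≤ min (s' j) (s' i) := le_min hc1 hlt.le
      have := min_le_right (s j) (s i)
      linarith
    push Not at hc1
    rw [min_eq_left (hc1.trans hlt).le]
    have hm := min_le_left (s j) (s i)
    by_cases hc2 : s' j < up' j
    · exfalso
      have hN2 := (h3' hB).trans (g4' hc2)
      have : ∑ k, min (s' k) (s' j) < ∑ k, min (s' k) (s' i) := by
        refine Finset.sum_lt_sum (fun k _ => min_le_min le_rfl (hc1.trans hlt).le)
          ⟨i, Finset.mem_univ i, ?_⟩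
        rw [min_self]
        exact (min_le_right _ _).trans_lt (hc1.trans hlt)
      linarith
    · linarith
  have hsum := Finset.sum_le_sum term
  rw [Finset.sum_neg_distrib, Finset.sum_sub_distrib] at hsum
  rw [← Finset.add_sum_erase _ _ (Finset.mem_univ i),
    ← Finset.add_sum_erase _ (fun j => min (s j) (s i)) (Finset.mem_univ i)] at hN
  rw [← Finset.add_sum_erase _ E (Finset.mem_univ i)]
  simp only [min_self] at hN
  have := hE i
  linarith

theorem clamp_lip (n : ℕ) (c : ℝ) (lo up lo' up' s s' E : Fin n → ℝ)
    (hs : ClampEq n c lo up s) (hs' : ClampEq n c lo' up' s')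
    (hlo : ∀ i, |lo i - lo' i| ≤ E i) (hup : ∀ i, |up i - up' i| ≤ E i) (i : Fin n) :
    |s i - s' i| ≤ ∑ j, E j := by
  have h1 := clamp_lip_aux n c lo up lo' up' s s' E hs hs' hlo hup i
  have h2 := clamp_lip_aux n c lo' up' lo up s' s E hs' hs
    (fun i => by rw [abs_sub_comm]; exact hlo i) (fun i => by rw [abs_sub_comm]; exact hup i) i
  exact abs_le.2 ⟨by linarith, by linarith⟩

def loB (a h q qb : ℝ) : ℝ := max 0 ((h - a * q) / (qb - q))

theorem loB_le (a h q qb : ℝ) (ha : 0 < a) (hh : 0 < h) (hq : 0 < q) (hqb : q < qb)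
    (hs : h ≤ a * qb) : loB a h q qb ≤ h / qb := by
  have hqb0 : 0 < qb := hq.trans hqb
  refine max_le (by positivity) ?_
  rw [div_le_div_iff₀ (by linarith) hqb0]
  nlinarith

theorem lo_lip_aux (a h q qb q' qb' δ ε : ℝ) (ha : 0 < a) (hh : 0 < h) (hq' : 0 < q')
    (hqb' : q' < qb')
    (hs' : h ≤ a * qb') (hδ0 : 0 < δ) (hδ : δ ≤ qb - q)
    (h1 : |q - q'| ≤ ε) (h2 : |qb - qb'| ≤ ε) :
    loB a h q' qb' - loB a h q qb ≤ a * ε / δ := by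
  have hε : 0 ≤ ε := (abs_nonneg _).trans h1
  obtain ⟨h1a, h1b⟩ := abs_le.1 h1
  obtain ⟨h2a, h2b⟩ := abs_le.1 h2
  have hl0 : 0 ≤ loB a h q qb := le_max_left _ _
  have hl0' : 0 ≤ loB a h q' qb' := le_max_left _ _
  have hl1 : h - a * q ≤ loB a h q qb * (qb - q) := by
    rw [← div_le_iff₀ (by linarith)]; exact le_max_right _ _
  have hla : loB a h q' qb' ≤ a := (loB_le a h q' qb' ha hh hq' hqb' hs').trans
    ((div_le_iff₀ (hq'.trans hqb')).2 hs')
  rw [le_div_iff₀ hδ0]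
  have haε : 0 ≤ a * ε := by positivity
  by_cases hc : loB a h q' qb' ≤ loB a h q qb
  · nlinarith
  push Not at hc
  have he : loB a h q' qb' * (qb' - q') = h - a * q' := by
    have h3 : loB a h q' qb' = (h - a * q') / (qb' - q') := by
      have h4 : 0 < loB a h q' qb' := hl0.trans_lt hc
      unfold loB at h4 ⊢
      rcases lt_max_iff.1 h4 with h5 | h5
      · exact absurd h5 (lt_irrefl _)
      · exact max_eq_right h5.le
    rw [h3, div_mul_cancel₀]
    linarith
  set l' := loB a h q' qb'
  set l := loB a h q qb
  have e1 : (l' - l) * δ ≤ (l' - l) * (qb - q) := mul_le_mul_of_nonneg_left hδ (by linarith)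
  have e2 : (l' - l) * (qb - q) ≤ (a - l') * (q - q') + l' * (qb - qb') := by nlinarith
  have e3 : (a - l') * (q - q') ≤ (a - l') * ε := mul_le_mul_of_nonneg_left h1b (by linarith)
  have e4 : l' * (qb - qb') ≤ l' * ε := mul_le_mul_of_nonneg_left h2b (by linarith)
  nlinarith

theorem lo_lip (a h q qb q' qb' δ ε : ℝ) (ha : 0 < a) (hh : 0 < h) (hq : 0 < q) (hq' : 0 < q')
    (hs : h ≤ a * qb) (hs' : h ≤ a * qb') (hδ0 : 0 < δ) (hδ : δ ≤ qb - q) (hδ' : δ ≤ qb' - q')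
    (h1 : |q - q'| ≤ ε) (h2 : |qb - qb'| ≤ ε) :
    |loB a h q qb - loB a h q' qb'| ≤ a * ε / δ := by
  have k1 := lo_lip_aux a h q qb q' qb' δ ε ha hh hq' (by linarith) hs' hδ0 hδ h1 h2
  have k2 := lo_lip_aux a h q' qb' q qb δ ε ha hh hq (by linarith) hs hδ0 hδ'
    (by rwa [abs_sub_comm]) (by rwa [abs_sub_comm])
  exact abs_le.2 ⟨by linarith, by linarith⟩

theorem up_lip_aux (a h qb qb' δ ε : ℝ) (ha : 0 < a) (hh : 0 < h)
    (hs' : h ≤ a * qb') (hδ0 : 0 < δ) (hδ : δ ≤ qb) (hδ' : δ ≤ qb') (h2 : |qb - qb'| ≤ ε) :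
    h / qb' - h / qb ≤ a * ε / δ := by
  have hε : 0 ≤ ε := (abs_nonneg _).trans h2
  obtain ⟨h2a, h2b⟩ := abs_le.1 h2
  have p : 0 < qb := by linarith
  have p' : 0 < qb' := by linarith
  have e : h / qb * qb = h := div_mul_cancel₀ _ p.ne'
  have e' : h / qb' * qb' = h := div_mul_cancel₀ _ p'.ne'
  have hu : h / qb' ≤ a := (div_le_iff₀ p').2 hs'
  have hu0 : 0 < h / qb' := by positivity
  rw [le_div_iff₀ hδ0]
  have haε : 0 ≤ a * ε := by positivity
  set u := h / qb
  set u' := h / qb'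
  by_cases hc : u' ≤ u
  · nlinarith
  push Not at hc
  have e1 : (u' - u) * δ ≤ (u' - u) * qb := mul_le_mul_of_nonneg_left hδ (by linarith)
  have e2 : (u' - u) * qb = u' * (qb - qb') := by linarith
  have e3 : u' * (qb - qb') ≤ u' * ε := mul_le_mul_of_nonneg_left h2b hu0.le
  have e4 : u' * ε ≤ a * ε := mul_le_mul_of_nonneg_right hu hε
  linarith

theorem up_lip (a h qb qb' δ ε : ℝ) (ha : 0 < a) (hh : 0 < h) (hs : h ≤ a * qb)
    (hs' : h ≤ a * qb') (hδ0 : 0 < δ) (hδ : δ ≤ qb) (hδ' : δ ≤ qb') (h2 : |qb - qb'| ≤ ε) :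
    |h / qb - h / qb'| ≤ a * ε / δ := by
  have k1 := up_lip_aux a h qb qb' δ ε ha hh hs' hδ0 hδ hδ' h2
  have k2 := up_lip_aux a h qb' qb δ ε ha hh hs hδ0 hδ' hδ (by rwa [abs_sub_comm])
  exact abs_le.2 ⟨by linarith, by linarith⟩

theorem lip_of_mono_deriv (M : ℝ) (hM : 0 < M) (f : ℝ → ℝ)
    (hd : DifferentiableOn ℝ f (Set.Icc 0 M)) (ha : AntitoneOn f (Set.Icc 0 M))
    (hm : MonotoneOn (derivWithin f (Set.Icc 0 M)) (Set.Icc 0 M)) :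
    ∀ x ∈ Set.Icc 0 M, ∀ y ∈ Set.Icc 0 M,
      |f x - f y| ≤ -(derivWithin f (Set.Icc 0 M) 0) * |x - y| := by
  intro x hx y hy
  refine Convex.norm_image_sub_le_of_norm_derivWithin_le hd (fun z hz => ?_)
    (convex_Icc 0 M) hy hx
  have h1 := hm ⟨le_rfl, hM.le⟩ hz hz.1
  have h2 : derivWithin f (Set.Icc 0 M) z ≤ 0 := ha.derivWithin_nonpos
  rw [Real.norm_eq_abs, abs_of_nonpos h2]
  linarith

theorem sum_min_mem (n : ℕ) (a s : Fin n → ℝ) (M : ℝ) (hM : ∑ i, a i ≤ M) (hs : memD n a s)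
    (u : ℝ) (hu : 0 ≤ u) : ∑ j, min (s j) u ∈ Set.Icc 0 M :=
  ⟨Finset.sum_nonneg fun j _ => le_min (hs j).1 hu,
    (Finset.sum_le_sum fun j _ => (min_le_left _ _).trans (hs j).2).trans hM⟩

theorem lob_mul (n : ℕ) (f : ℝ → ℝ) (i : Fin n) (s : Fin n → ℝ) :
    s i * lob n f i s = ∫ u in (0:ℝ)..(s i), f (∑ j, min (s j) u) := by
  unfold lob
  split_ifs with h
  · simp [h]
  · rw [mul_div_cancel₀ _ h]

theorem lob_eq (n : ℕ) (f : ℝ → ℝ) (hf0 : f 0 = 1) (i : Fin n) (a s : Fin n → ℝ)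
    (hs : memD n a s) :
    lob n f i s = ∫ v in (0:ℝ)..1, f (∑ j, min (s j) (s i * v)) := by
  unfold lob
  split_ifs with h
  · have : ∀ v : ℝ, ∑ j, min (s j) (s i * v) = 0 := fun v =>
      Finset.sum_eq_zero fun j _ => by rw [h, zero_mul]; exact min_eq_right (hs j).1
    simp [this, hf0]
  · have := intervalIntegral.mul_integral_comp_mul_left (a := 0) (b := 1)
      (f := fun u => f (∑ j, min (s j) u)) (s i)
    rw [mul_zero, mul_one] at this
    rw [← this, mul_div_cancel_left₀ _ h]

theorem cont_integrand (n : ℕ) (f : ℝ → ℝ) (M : ℝ) (hf : ContinuousOn f (Set.Icc 0 M))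
    (a s : Fin n → ℝ) (hM : ∑ i, a i ≤ M) (hs : memD n a s) (i : Fin n) :
    ContinuousOn (fun v => f (∑ j, min (s j) (s i * v))) (Set.Icc 0 1) := by
  refine hf.comp (Continuous.continuousOn (by fun_prop)) fun v hv => ?_
  exact sum_min_mem n a s M hM hs _ (mul_nonneg (hs i).1 hv.1)

theorem int_integrand (n : ℕ) (f : ℝ → ℝ) (M : ℝ) (hf : ContinuousOn f (Set.Icc 0 M))
    (a s : Fin n → ℝ) (hM : ∑ i, a i ≤ M) (hs : memD n a s) (i : Fin n) :
    IntervalIntegrable (fun v => f (∑ j, min (s j) (s i * v))) MeasureTheory.volume 0 1 := by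
  apply ContinuousOn.intervalIntegrable
  rw [Set.uIcc_of_le zero_le_one]
  exact cont_integrand n f M hf a s hM hs i

theorem lob_anti (n : ℕ) (f : ℝ → ℝ) (M : ℝ) (hf : Assumption2 M f)
    (a s : Fin n → ℝ) (ha : ∀ i, 0 < a i) (hM : ∑ i, a i ≤ M) (hs : memD n a s) (i : Fin n) :
    lob n f i a ≤ lob n f i s := by
  have haD : memD n a a := fun j => ⟨(ha j).le, le_rfl⟩
  have hc := hf.smooth.continuousOn
  rw [lob_eq n f hf.f_zero i a a haD, lob_eq n f hf.f_zero i a s hs]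
  refine intervalIntegral.integral_mono_on zero_le_one (int_integrand n f M hc a a hM haD i)
    (int_integrand n f M hc a s hM hs i) fun v hv => ?_
  refine hf.anti.antitoneOn (sum_min_mem n a s M hM hs _ (mul_nonneg (hs i).1 hv.1))
    (sum_min_mem n a a M hM haD _ (mul_nonneg (haD i).1 hv.1)) ?_
  exact Finset.sum_le_sum fun j _ => min_le_min (hs j).2
    (mul_le_mul_of_nonneg_right (hs i).2 hv.1)

theorem lob_lip (n : ℕ) (f : ℝ → ℝ) (M l : ℝ) (hf : Assumption2 M f) (hl0 : 0 ≤ l)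
    (hl : ∀ x ∈ Set.Icc 0 M, ∀ y ∈ Set.Icc 0 M, |f x - f y| ≤ l * |x - y|)
    (a s t : Fin n → ℝ) (hM : ∑ i, a i ≤ M) (hs : memD n a s)
    (ht : memD n a t) (i : Fin n) :
    |lob n f i s - lob n f i t| ≤ (n / 2 * l) * ∑ j, |s j - t j| := by
  have hc := hf.smooth.continuousOn
  rw [lob_eq n f hf.f_zero i a s hs, lob_eq n f hf.f_zero i a t ht,
    ← intervalIntegral.integral_sub (int_integrand n f M hc a s hM hs i)
      (int_integrand n f M hc a t hM ht i)]
  set R := ∑ j ∈ Finset.univ.erase i, |s j - t j| with hR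
  have hbound : ∀ v ∈ Set.Icc (0:ℝ) 1,
      |f (∑ j, min (s j) (s i * v)) - f (∑ j, min (t j) (t i * v))|
        ≤ l * (n * |s i - t i| * v + R) := by
    intro v hv
    refine (hl _ (sum_min_mem n a s M hM hs _ (mul_nonneg (hs i).1 hv.1)) _
      (sum_min_mem n a t M hM ht _ (mul_nonneg (ht i).1 hv.1))).trans ?_
    refine mul_le_mul_of_nonneg_left ?_ hl0
    rw [← Finset.sum_sub_distrib]
    refine (Finset.abs_sum_le_sum_abs _ _).trans ?_
    have hv1 : |s i * v - t i * v| = |s i - t i| * v := by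
      rw [← sub_mul, abs_mul, abs_of_nonneg hv.1]
    have e : (n : ℝ) * |s i - t i| * v + R = ∑ j, (|s i - t i| * v +
        if j = i then 0 else |s j - t j|) := by
      rw [Finset.sum_add_distrib, ← Finset.add_sum_erase _ (fun j => if j = i then _ else _)
        (Finset.mem_univ i)]
      simp only [Finset.sum_const, Finset.card_univ, Fintype.card_fin, nsmul_eq_mul, if_true,
        zero_add, hR]
      congr 1
      · ring
      · exact Finset.sum_congr rfl fun j hj => by rw [if_neg (Finset.ne_of_mem_erase hj)]
    rw [e]
    refine Finset.sum_le_sum fun j _ => ?_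
    split_ifs with hj
    · subst hj
      have x1 : min (s j) (s j * v) = s j * v := min_eq_right (mul_le_of_le_one_right (hs j).1 hv.2)
      have x2 : min (t j) (t j * v) = t j * v := min_eq_right (mul_le_of_le_one_right (ht j).1 hv.2)
      rw [x1, x2, hv1, add_zero]
    · refine (abs_min_sub_min_le_max _ _ _ _).trans ?_
      rw [hv1]
      refine max_le ?_ ?_
      · have := mul_nonneg (abs_nonneg (s i - t i)) hv.1
        linarith
      · have := abs_nonneg (s j - t j)
        linarith
  have h1 : |∫ v in (0:ℝ)..1, (f (∑ j, min (s j) (s i * v)) - f (∑ j, min (t j) (t i * v)))|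
      ≤ ∫ v in (0:ℝ)..1, l * (n * |s i - t i| * v + R) := by
    refine (intervalIntegral.abs_integral_le_integral_abs zero_le_one).trans ?_
    refine intervalIntegral.integral_mono_on zero_le_one
      ((int_integrand n f M hc a s hM hs i).sub (int_integrand n f M hc a t hM ht i)).abs
      (Continuous.intervalIntegrable (by fun_prop) _ _) hbound
  refine h1.trans ?_
  have h2 : ∫ v in (0:ℝ)..1, l * (n * |s i - t i| * v + R) = l * (n * |s i - t i| / 2 + R) := by
    rw [intervalIntegral.integral_const_mul, intervalIntegral.integral_add
      (Continuous.intervalIntegrable (by fun_prop) _ _)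
      (Continuous.intervalIntegrable (by fun_prop) _ _),
      intervalIntegral.integral_const_mul, integral_id]
    simp
    ring_nf
    simp
  rw [h2, ← Finset.add_sum_erase _ _ (Finset.mem_univ i), ← hR]
  have hRR : R ≤ n / 2 * R := by
    rcases Nat.lt_or_ge n 2 with hn | hn
    · have : R = 0 := by
        have : Subsingleton (Fin n) := Fin.subsingleton_iff_le_one.2 (by omega)
        rw [hR]
        refine Finset.sum_eq_zero fun j hj => ?_
        exact absurd (Subsingleton.elim j i) (Finset.ne_of_mem_erase hj)
      simp [this]
    · have hR0 : 0 ≤ R := Finset.sum_nonneg fun _ _ => abs_nonneg _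
      have : (2:ℝ) ≤ n := by exact_mod_cast hn
      nlinarith
  calc l * (n * |s i - t i| / 2 + R) ≤ l * (n * |s i - t i| / 2 + n / 2 * R) := by gcongr
    _ = _ := by ring

theorem exists_c (M r : ℝ) (f : ℝ → ℝ) (hM : 0 < M) (hr : 0 ≤ r) (hf : Assumption2 M f) :
    ∃ c : ℝ, 0 ≤ c ∧ ∀ x ∈ Set.Icc 0 M, (x ≤ c ↔ 1 ≤ (1 + r) * f x) ∧
      (c ≤ x ↔ (1 + r) * f x ≤ 1) := by
  have h0m : (0:ℝ) ∈ Set.Icc 0 M := ⟨le_rfl, hM.le⟩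
  have hMm : M ∈ Set.Icc 0 M := ⟨hM.le, le_rfl⟩
  have hr1 : 0 < 1 + r := by linarith
  by_cases h : 1 < (1 + r) * f M
  · refine ⟨M + 1, by linarith, fun x hx => ?_⟩
    have h1 : f M ≤ f x := hf.anti.antitoneOn hx hMm hx.2
    have h2 : 1 < (1 + r) * f x := h.trans_le (mul_le_mul_of_nonneg_left h1 hr1.le)
    have := hx.2
    exact ⟨⟨fun _ => h2.le, fun _ => by linarith⟩, ⟨fun _ => by linarith, fun _ => by linarith⟩⟩
  · push Not at h
    have := intermediate_value_Icc' hM.le hf.smooth.continuousOn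
    have hm : 1 / (1 + r) ∈ Set.Icc (f M) (f 0) := by
      rw [hf.f_zero]
      refine ⟨?_, ?_⟩
      · rw [le_div_iff₀ hr1]; linarith
      · rw [div_le_one hr1]; linarith
    obtain ⟨c, hcm, hc⟩ := this hm
    have hc1 : (1 + r) * f c = 1 := by rw [hc]; field_simp
    refine ⟨c, hcm.1, fun x hx => ?_⟩
    rw [← hf.anti.le_iff_ge hcm hx, ← hf.anti.le_iff_ge hx hcm]
    constructor
    · conv_rhs => lhs; rw [← hc1]
      exact (mul_le_mul_iff_right₀ hr1).symm
    · conv_rhs => rhs; rw [← hc1]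
      exact (mul_le_mul_iff_right₀ hr1).symm

def KK (n : ℕ) (s : Fin n → ℝ) (i : Fin n) (u : ℝ) : ℝ :=
  u + ∑ j ∈ Finset.univ.erase i, min (s j) u

theorem KK_update (n : ℕ) (s : Fin n → ℝ) (i : Fin n) (x u : ℝ) (hu : u ≤ x) :
    ∑ j, min (Function.update s i x j) u = KK n s i u := by
  rw [← Finset.add_sum_erase _ _ (Finset.mem_univ i), Function.update_self, min_eq_right hu, KK]
  congr 1
  refine Finset.sum_congr rfl fun j hj => ?_
  rw [Function.update_of_ne (Finset.ne_of_mem_erase hj)]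

theorem KK_cont (n : ℕ) (s : Fin n → ℝ) (i : Fin n) : Continuous (KK n s i) := by
  unfold KK; fun_prop

theorem KK_mono (n : ℕ) (s : Fin n → ℝ) (i : Fin n) : Monotone (KK n s i) := by
  intro x y hxy
  unfold KK
  exact add_le_add hxy (Finset.sum_le_sum fun j _ => min_le_min le_rfl hxy)

theorem KK_self (n : ℕ) (s : Fin n → ℝ) (i : Fin n) : ∑ j, min (s j) (s i) = KK n s i (s i) := by
  have := KK_update n s i (s i) (s i) le_rfl
  rwa [Function.update_eq_self] at this

theorem memD_update (n : ℕ) (a s : Fin n → ℝ) (hs : memD n a s) (i : Fin n) (x : ℝ)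
    (hx : x ∈ Set.Icc 0 (a i)) : memD n a (Function.update s i x) := by
  intro j
  by_cases hj : j = i
  · subst hj; simpa using hx
  · rw [Function.update_of_ne hj]; exact hs j

theorem KK_mem (n : ℕ) (a s : Fin n → ℝ) (M : ℝ) (hM : ∑ i, a i ≤ M) (hs : memD n a s)
    (i : Fin n) (u : ℝ) (hu : u ∈ Set.Icc 0 (a i)) : KK n s i u ∈ Set.Icc 0 M := by
  rw [← KK_update n s i u u le_rfl]
  exact sum_min_mem n a _ M hM (memD_update n a s hs i u hu) u hu.1

theorem int_phi (n : ℕ) (a s : Fin n → ℝ) (M r : ℝ) (f : ℝ → ℝ) (hf : ContinuousOn f (Set.Icc 0 M))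
    (hM : ∑ i, a i ≤ M) (hs : memD n a s) (i : Fin n) (x y : ℝ) (hx : x ∈ Set.Icc 0 (a i))
    (hy : y ∈ Set.Icc 0 (a i)) :
    IntervalIntegrable (fun u => (1 + r) * f (KK n s i u)) MeasureTheory.volume x y := by
  apply ContinuousOn.intervalIntegrable
  refine ContinuousOn.mul continuousOn_const (hf.comp (KK_cont n s i).continuousOn ?_)
  intro u hu
  exact KK_mem n a s M hM hs i u (Set.uIcc_subset_Icc hx hy hu)

theorem obj_update (n : ℕ) (a s h : Fin n → ℝ) (r : ℝ) (f : ℝ → ℝ)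
    (i : Fin n) (x : ℝ) (hx : x ∈ Set.Icc 0 (a i)) :
    obj n r h (lob n f) i (Function.update s i x)
      = x + r * h i - ∫ u in (0:ℝ)..x, (1 + r) * f (KK n s i u) := by
  have h1 := lob_mul n f i (Function.update s i x)
  rw [Function.update_self] at h1
  have h2 : ∫ u in (0:ℝ)..x, f (∑ j, min (Function.update s i x j) u)
      = ∫ u in (0:ℝ)..x, f (KK n s i u) := by
    refine intervalIntegral.integral_congr fun u hu => ?_
    rw [Set.uIcc_of_le hx.1] at hu
    simp only [KK_update n s i x u hu.2]
  rw [h2] at h1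
  rw [intervalIntegral.integral_const_mul, ← h1]
  unfold obj
  rw [Function.update_self]
  ring

theorem obj_diff (n : ℕ) (a s h : Fin n → ℝ) (M r : ℝ) (f : ℝ → ℝ)
    (hf : ContinuousOn f (Set.Icc 0 M))
    (hM : ∑ i, a i ≤ M) (hs : memD n a s) (i : Fin n) (x y : ℝ) (hx : x ∈ Set.Icc 0 (a i))
    (hy : y ∈ Set.Icc 0 (a i)) :
    obj n r h (lob n f) i (Function.update s i y) - obj n r h (lob n f) i (Function.update s i x)
      = (y - x) - ∫ u in x..y, (1 + r) * f (KK n s i u) := by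
  have h0 : (0:ℝ) ∈ Set.Icc 0 (a i) := ⟨le_rfl, hx.1.trans hx.2⟩
  rw [obj_update n a s h r f i x hx, obj_update n a s h r f i y hy,
    ← intervalIntegral.integral_interval_sub_left
      (int_phi n a s M r f hf hM hs i 0 y h0 hy) (int_phi n a s M r f hf hM hs i 0 x h0 hx)]
  ring

theorem phi_anti (n : ℕ) (a s : Fin n → ℝ) (M r : ℝ) (f : ℝ → ℝ) (hr : 0 ≤ r)
    (hf : Assumption2 M f)
    (hM : ∑ i, a i ≤ M) (hs : memD n a s) (i : Fin n) (x y : ℝ) (hx : x ∈ Set.Icc 0 (a i))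
    (hy : y ∈ Set.Icc 0 (a i)) (hxy : x ≤ y) :
    (1 + r) * f (KK n s i y) ≤ (1 + r) * f (KK n s i x) :=
  mul_le_mul_of_nonneg_left (hf.anti.antitoneOn (KK_mem n a s M hM hs i x hx)
    (KK_mem n a s M hM hs i y hy) (KK_mono n s i hxy)) (by linarith)

/-- bounds on the integral -/
theorem phi_int_bounds (n : ℕ) (a s : Fin n → ℝ) (M r : ℝ) (f : ℝ → ℝ) (hr : 0 ≤ r)
    (hf : Assumption2 M f)
    (hM : ∑ i, a i ≤ M) (hs : memD n a s) (i : Fin n) (x y : ℝ) (hx : x ∈ Set.Icc 0 (a i))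
    (hy : y ∈ Set.Icc 0 (a i)) (hxy : x ≤ y) :
    (y - x) * ((1 + r) * f (KK n s i y)) ≤ ∫ u in x..y, (1 + r) * f (KK n s i u) ∧
    ∫ u in x..y, (1 + r) * f (KK n s i u) ≤ (y - x) * ((1 + r) * f (KK n s i x)) := by
  have hi := int_phi n a s M r f hf.smooth.continuousOn hM hs i x y hx hy
  constructor
  · have := intervalIntegral.integral_mono_on hxy
      (intervalIntegrable_const (c := (1 + r) * f (KK n s i y))) hi fun u hu =>
        phi_anti n a s M r f hr hf hM hs i u y ⟨hx.1.trans hu.1, hu.2.trans hy.2⟩ hy hu.2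
    rwa [intervalIntegral.integral_const, smul_eq_mul] at this
  · have := intervalIntegral.integral_mono_on hxy hi
      (intervalIntegrable_const (c := (1 + r) * f (KK n s i x))) fun u hu =>
        phi_anti n a s M r f hr hf hM hs i x u hx ⟨hx.1.trans hu.1, hu.2.trans hy.2⟩ hu.1
    rwa [intervalIntegral.integral_const, smul_eq_mul] at this

theorem nash_iff (n : ℕ) (a h : Fin n → ℝ) (r M q c : ℝ) (f : ℝ → ℝ) (qb s : Fin n → ℝ)
    (hr : 0 ≤ r) (hf : Assumption2 M f) (hM : ∑ i, a i ≤ M)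
    (hc : ∀ x ∈ Set.Icc 0 M, (x ≤ c ↔ 1 ≤ (1 + r) * f x) ∧ (c ≤ x ↔ (1 + r) * f x ≤ 1))
    (hq : 0 < q) (hqb : ∀ i, q < qb i)
    (hsol : ∀ i, h i ≤ a i * qb i) (hs : memD n a s) :
    NashP2 n a h r q qb (lob n f) s ↔
      ClampEq n c (fun i => loB (a i) (h i) q (qb i)) (fun i => h i / qb i) s := by
  have hfeas : ∀ i x, feasP2 n a h q qb i x ↔ loB (a i) (h i) q (qb i) ≤ x ∧ x ≤ h i / qb i := by
    intro i x
    have : h i / qb i ≤ a i := (div_le_iff₀ (hq.trans (hqb i))).2 (hsol i)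
    unfold feasP2 loB
    rw [max_le_iff]
    constructor
    · rintro ⟨⟨h1, h2⟩, h3, h4⟩
      exact ⟨⟨h1, h4⟩, h3⟩
    · rintro ⟨⟨h1, h4⟩, h3⟩
      exact ⟨⟨h1, h3.trans this⟩, h3, h4⟩
  have hcont := hf.smooth.continuousOn
  unfold NashP2 ClampEq
  refine forall_congr' fun i => ?_
  constructor
  · rintro ⟨h1, _⟩
    obtain ⟨h2, h3⟩ := h1 (hsol i)
    obtain ⟨h4, h5⟩ := (hfeas i _).1 h2
    refine ⟨h4, h5, fun hlt => ?_, fun hlt => ?_⟩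
    · rw [KK_self]
      have hcl : IsClosed {y | KK n s i y ≤ c} := isClosed_le (KK_cont n s i) continuous_const
      have hsub : Set.Ico (loB (a i) (h i) q (qb i)) (s i) ⊆ {y | KK n s i y ≤ c} := by
        intro y hy
        have hyf : feasP2 n a h q qb i y := (hfeas i y).2 ⟨hy.1, hy.2.le.trans h5⟩
        have h6 := h3 y hyf
        have h7 := obj_diff n a s h M r f hcont hM hs i y (s i) hyf.1 (hs i)
        rw [Function.update_eq_self] at h7
        have h8 := (phi_int_bounds n a s M r f hr hf hM hs i y (s i) hyf.1 (hs i) hy.2.le).2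
        refine ((hc _ (KK_mem n a s M hM hs i y hyf.1)).1).2 ?_
        have h9 : 0 < s i - y := sub_pos.2 hy.2
        by_contra h10
        push Not at h10
        nlinarith
      have := closure_minimal hsub hcl
      rw [closure_Ico hlt.ne] at this
      exact this ⟨hlt.le, le_rfl⟩
    · rw [KK_self]
      have hcl : IsClosed {y | c ≤ KK n s i y} := isClosed_le continuous_const (KK_cont n s i)
      have hsub : Set.Ioc (s i) (h i / qb i) ⊆ {y | c ≤ KK n s i y} := by
        intro y hy
        have hyf : feasP2 n a h q qb i y := (hfeas i y).2 ⟨h4.trans hy.1.le, hy.2⟩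
        have h6 := h3 y hyf
        have h7 := obj_diff n a s h M r f hcont hM hs i (s i) y (hs i) hyf.1
        rw [Function.update_eq_self] at h7
        have h8 := (phi_int_bounds n a s M r f hr hf hM hs i (s i) y (hs i) hyf.1 hy.1.le).1
        refine ((hc _ (KK_mem n a s M hM hs i y hyf.1)).2).2 ?_
        have h9 : 0 < y - s i := sub_pos.2 hy.1
        by_contra h10
        push Not at h10
        nlinarith
      have := closure_minimal hsub hcl
      rw [closure_Ioc hlt.ne] at this
      exact this ⟨le_rfl, hlt.le⟩
  · rintro ⟨h1, h2, h3, h4⟩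
    refine ⟨fun _ => ⟨(hfeas i _).2 ⟨h1, h2⟩, fun x hx => ?_⟩,
      fun hh => absurd hh (not_lt.2 (hsol i))⟩
    have hx' := (hfeas i x).1 hx
    rw [KK_self] at h3 h4
    have hKm := KK_mem n a s M hM hs i (s i) (hs i)
    rcases lt_trichotomy x (s i) with hlt | heq | hlt
    · have h5 := ((hc _ hKm).1).1 (h3 (hx'.1.trans_lt hlt))
      have h7 := obj_diff n a s h M r f hcont hM hs i x (s i) hx.1 (hs i)
      rw [Function.update_eq_self] at h7
      have h8 := (phi_int_bounds n a s M r f hr hf hM hs i x (s i) hx.1 (hs i) hlt.le).1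
      nlinarith
    · rw [heq, Function.update_eq_self]
    · have h5 := ((hc _ hKm).2).1 (h4 (hlt.trans_le hx'.2))
      have h7 := obj_diff n a s h M r f hcont hM hs i (s i) x (hs i) hx.1
      rw [Function.update_eq_self] at h7
      have h8 := (phi_int_bounds n a s M r f hr hf hM hs i (s i) x (hs i) hx.1 hlt.le).2
      nlinarith

/-- A strict contraction for the l1 distance on the box has a fixed point. -/
theorem fixed_point (n : ℕ) (a : Fin n → ℝ) (ha : ∀ i, 0 < a i) (Φ : (Fin n → ℝ) → Fin n → ℝ)
    (hmaps : ∀ s, memD n a s → memD n a (Φ s))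
    (hcontr : ∀ s t, memD n a s → memD n a t → s ≠ t →
      ∑ i, |Φ s i - Φ t i| < ∑ i, |s i - t i|) : ∃ s, memD n a s ∧ Φ s = s := by
  have hD : {s | memD n a s} = Set.Icc (0 : Fin n → ℝ) a := by
    ext s
    simp only [memD, Set.mem_setOf_eq, Set.mem_Icc, Pi.le_def, Pi.zero_apply, forall_and]
  have hcomp : IsCompact {s | memD n a s} := by rw [hD]; exact isCompact_Icc
  have hne : ({s | memD n a s}).Nonempty := ⟨a, fun j => ⟨(ha j).le, le_rfl⟩⟩
  have hcoord : ∀ i, ContinuousOn (fun s => Φ s i) {s | memD n a s} := by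
    intro i s hs
    rw [ContinuousWithinAt, tendsto_iff_dist_tendsto_zero]
    have hz : Filter.Tendsto (fun t : Fin n → ℝ => ∑ j, |t j - s j|)
        (nhdsWithin s {s | memD n a s}) (nhds 0) := by
      have : Continuous (fun t : Fin n → ℝ => ∑ j, |t j - s j|) := by fun_prop
      have h2 := this.tendsto s
      simp only [sub_self, abs_zero, Finset.sum_const_zero] at h2
      exact h2.mono_left nhdsWithin_le_nhds
    refine squeeze_zero' (Filter.Eventually.of_forall fun _ => dist_nonneg) ?_ hz
    filter_upwards [self_mem_nhdsWithin] with t ht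
    rw [Real.dist_eq]
    refine (Finset.single_le_sum (f := fun j => |Φ t j - Φ s j|)
      (fun j _ => abs_nonneg _) (Finset.mem_univ i)).trans ?_
    by_cases hts : t = s
    · simp [hts]
    · exact (hcontr t s ht hs hts).le
  have hcont : ContinuousOn (fun s => ∑ i, |Φ s i - s i|) {s | memD n a s} := by
    refine continuousOn_finset_sum _ fun i _ => ?_
    exact ((hcoord i).sub (continuous_apply i).continuousOn).abs
  obtain ⟨s, hs, hmin⟩ := hcomp.exists_isMinOn hne hcont
  refine ⟨s, hs, ?_⟩
  by_contra hne
  have h1 := hcontr (Φ s) s (hmaps s hs) hs hne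
  have h2 := hmin (hmaps s hs)
  simp only [Set.mem_setOf_eq] at h2
  linarith

/-- under LOB pricing, Assumption 2, Assumptions 1(3)-1(4) on a continuously
differentiable haircut `g`, fundamental solvency of all banks, and the contraction condition
`-nM·min((n/2)f'(0), g'(0)) < min_j min_{s ∈ D} (f̄ⱼ(s) − g(∑ sᵢ))`, the clearing price
vector is unique. -/
theorem lob_unique_clearing_prices
    (n : ℕ) (a h : Fin n → ℝ) (r M : ℝ) (f g : ℝ → ℝ)
    (ha : ∀ i, 0 < a i) (hh : ∀ i, 0 < h i) (hr : 0 ≤ r)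
    (hM : ∑ i, a i ≤ M)
    (hf : Assumption2 M f)
    (hg_mem : ∀ x ∈ Set.Icc (0 : ℝ) M, g x ∈ Set.Ioc (0 : ℝ) 1)
    (hg_smooth : ContDiffOn ℝ 1 g (Set.Icc 0 M))
    (hg_convex : ConvexOn ℝ (Set.Icc 0 M) g)
    (hg_anti : StrictAntiOn g (Set.Icc 0 M))
    (hg_lt : ∀ s, memD n a s → ∀ i, g (∑ j, s j) < lob n f i s)
    (hg_total_mono : ∀ i s, memD n a s →
      StrictMonoOn
        (fun x => x * lob n f i (Function.update s i x)
          + (a i - x) * g (∑ j, Function.update s i x j)) (Set.Icc 0 (a i)))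
    (hsolv : ∀ i, h i ≤ a i * lob n f i a)
    (hcond : ∀ j : Fin n, ∀ s : Fin n → ℝ, memD n a s →
      -(n : ℝ) * M * min (((n : ℝ)/2) * derivWithin f (Set.Icc 0 M) 0)
          (derivWithin g (Set.Icc 0 M) 0)
        < lob n f j s - g (∑ i, s i)) :
    ∃! p : ℝ × (Fin n → ℝ), ClearingLOB n a h r f g p.1 p.2 := by
  rcases Nat.eq_zero_or_pos n with hn | hn
  · subst hn
    refine ⟨(g 0, fun i => i.elim0), ⟨fun i => i.elim0, fun i => i.elim0, fun i => i.elim0,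
      by simp, fun i => i.elim0⟩, ?_⟩
    rintro ⟨q, qb⟩ ⟨s, _, _, hq, _⟩
    refine Prod.ext ?_ (funext fun i => i.elim0)
    simpa using hq
  have : Nonempty (Fin n) := ⟨⟨0, hn⟩⟩
  have hM0 : 0 < M := lt_of_lt_of_le
    (Finset.sum_pos (fun i _ => ha i) Finset.univ_nonempty) hM
  have h0m : (0:ℝ) ∈ Set.Icc 0 M := ⟨le_rfl, hM0.le⟩
  set f' := derivWithin f (Set.Icc 0 M) 0 with hf'
  set g' := derivWithin g (Set.Icc 0 M) 0 with hg'
  have hf'0 : f' ≤ 0 := hf.anti.antitoneOn.derivWithin_nonpos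
  have hg'0 : g' ≤ 0 := hg_anti.antitoneOn.derivWithin_nonpos
  have hflip := lip_of_mono_deriv M hM0 f (hf.smooth.differentiableOn (by norm_num))
    hf.anti.antitoneOn hf.deriv_mono
  have hgd : DifferentiableOn ℝ g (Set.Icc 0 M) := hg_smooth.differentiableOn (by norm_num)
  have hglip := lip_of_mono_deriv M hM0 g hgd hg_anti.antitoneOn
    (hg_convex.monotoneOn_derivWithin hgd)
  rw [← hf'] at hflip
  rw [← hg'] at hglip
  obtain ⟨L, hL⟩ : ∃ L, L = -min ((n : ℝ) / 2 * f') g' := ⟨_, rfl⟩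
  have hLf : (n : ℝ) / 2 * (-f') ≤ L := by
    have := min_le_left ((n : ℝ) / 2 * f') g'
    linarith
  have hLg : -g' ≤ L := by
    have := min_le_right ((n : ℝ) / 2 * f') g'
    linarith
  have hL0 : 0 ≤ L := by linarith
  have hcond' : ∀ j s, memD n a s → n * M * L < lob n f j s - g (∑ i, s i) := by
    intro j s hs
    have := hcond j s hs
    rw [hL]
    linarith
  have hsum_mem : ∀ s, memD n a s → ∑ i, s i ∈ Set.Icc 0 M := fun s hs =>
    ⟨Finset.sum_nonneg fun i _ => (hs i).1, (Finset.sum_le_sum fun i _ => (hs i).2).trans hM⟩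
  have hqpos : ∀ s, memD n a s → 0 < g (∑ i, s i) := fun s hs => (hg_mem _ (hsum_mem s hs)).1
  have hsol : ∀ s, memD n a s → ∀ i, h i ≤ a i * lob n f i s := fun s hs i =>
    (hsolv i).trans (mul_le_mul_of_nonneg_left (lob_anti n f M hf a s ha hM hs i) (ha i).le)
  obtain ⟨c, hc0, hc⟩ := exists_c M r f hM0 hr hf
  -- prices are Lipschitz
  have hqlip : ∀ s t, memD n a s → memD n a t →
      |g (∑ i, s i) - g (∑ i, t i)| ≤ L * ∑ i, |s i - t i| := by
    intro s t hs ht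
    refine (hglip _ (hsum_mem s hs) _ (hsum_mem t ht)).trans ?_
    rw [← Finset.sum_sub_distrib]
    exact mul_le_mul hLg (Finset.abs_sum_le_sum_abs _ _) (abs_nonneg _) hL0
  have hqblip : ∀ s t, memD n a s → memD n a t → ∀ i,
      |lob n f i s - lob n f i t| ≤ L * ∑ i, |s i - t i| := by
    intro s t hs ht i
    refine (lob_lip n f M (-f') hf (by linarith) hflip a s t hM hs ht i).trans ?_
    exact mul_le_mul_of_nonneg_right hLf (Finset.sum_nonneg fun _ _ => abs_nonneg _)
  set Q : (Fin n → ℝ) → (Fin n → ℝ) → Prop := fun s s' =>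
    ClampEq n c (fun i => loB (a i) (h i) (g (∑ j, s j)) (lob n f i s))
      (fun i => h i / lob n f i s) s' with hQ
  have hstrict : ∀ s t s' t', memD n a s → memD n a t → Q s s' → Q t t' → s ≠ t →
      ∑ i, |s' i - t' i| < ∑ i, |s i - t i| := by
    intro s t s' t' hs ht hs' ht' hst
    have hpos : 0 < ∑ i, |s i - t i| := by
      obtain ⟨i, hi⟩ := Function.ne_iff.1 hst
      exact Finset.sum_pos' (fun _ _ => abs_nonneg _)
        ⟨i, Finset.mem_univ i, abs_pos.2 (sub_ne_zero.2 hi)⟩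
    set S := ∑ i, |s i - t i| with hS
    obtain ⟨i0, hi0⟩ := Finite.exists_min (fun i => min (lob n f i s - g (∑ j, s j))
      (lob n f i t - g (∑ j, t j)))
    obtain ⟨δ, hδ⟩ : ∃ δ, δ = min (lob n f i0 s - g (∑ j, s j))
      (lob n f i0 t - g (∑ j, t j)) := ⟨_, rfl⟩
    rw [← hδ] at hi0
    have hδB : n * M * L < δ := by
      rw [hδ]; exact lt_min (hcond' _ _ hs) (hcond' _ _ ht)
    have hB0 : 0 ≤ n * M * L := by positivity
    have hδ0 : 0 < δ := hB0.trans_lt hδB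
    have hδs : ∀ i, δ ≤ lob n f i s - g (∑ j, s j) := fun i => (hi0 i).trans (min_le_left _ _)
    have hδt : ∀ i, δ ≤ lob n f i t - g (∑ j, t j) := fun i => (hi0 i).trans (min_le_right _ _)
    have hqs := hqpos s hs
    have hqt := hqpos t ht
    have hlip := clamp_lip n c _ _ _ _ s' t' (fun i => a i * (L * S) / δ) hs' ht'
      (fun i => lo_lip (a i) (h i) _ _ _ _ δ (L * S) (ha i) (hh i) hqs hqt (hsol s hs i)
        (hsol t ht i) hδ0 (hδs i) (hδt i) (hqlip s t hs ht) (hqblip s t hs ht i))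
      (fun i => up_lip (a i) (h i) _ _ δ (L * S) (ha i) (hh i) (hsol s hs i)
        (hsol t ht i) hδ0 (by linarith [hδs i]) (by linarith [hδt i]) (hqblip s t hs ht i))
    have hE : ∑ i, a i * (L * S) / δ ≤ M * (L * S) / δ := by
      rw [← Finset.sum_div, ← Finset.sum_mul]
      gcongr
    calc ∑ i, |s' i - t' i| ≤ ∑ _i : Fin n, M * (L * S) / δ :=
          Finset.sum_le_sum fun i _ => (hlip i).trans hE
      _ = (n * M * L) * S / δ := by
          rw [Finset.sum_const, Finset.card_univ, Fintype.card_fin, nsmul_eq_mul]; ring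
      _ < S := by
          rw [div_lt_iff₀ hδ0, mul_comm]
          exact mul_lt_mul_of_pos_left hδB hpos
  have hex : ∀ s, ∃ s', memD n a s → Q s s' := by
    intro s
    by_cases hs : memD n a s
    · obtain ⟨s', hs'⟩ := clamp_exists n c
        (fun i => loB (a i) (h i) (g (∑ j, s j)) (lob n f i s))
        (fun i => h i / lob n f i s) hc0 (fun i => le_max_left _ _)
        (fun i => loB_le _ _ _ _ (ha i) (hh i) (hqpos s hs) (hg_lt s hs i) (hsol s hs i))
      exact ⟨s', fun _ => hs'⟩
    · exact ⟨s, fun hh => absurd hh hs⟩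
  choose Φ hΦ using hex
  have hmaps : ∀ s, memD n a s → memD n a (Φ s) := by
    intro s hs i
    obtain ⟨h1, h2, _⟩ := hΦ s hs i
    refine ⟨(le_max_left _ _).trans h1, h2.trans ?_⟩
    exact (div_le_iff₀ ((hqpos s hs).trans (hg_lt s hs i))).2 (hsol s hs i)
  obtain ⟨s, hs, hfix⟩ := fixed_point n a ha Φ hmaps fun s t hs ht hst =>
    hstrict s t _ _ hs ht (hΦ s hs) (hΦ t ht) hst
  have hQs : Q s s := by
    have := hΦ s hs
    rwa [hfix] at this
  have hnash : ∀ t, memD n a t → (NashP2 n a h r (g (∑ i, t i)) (fun i => lob n f i t)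
      (lob n f) t ↔ Q t t) := fun t ht =>
    nash_iff n a h r M _ c f _ t hr hf hM hc (hqpos t ht) (hg_lt t ht) (hsol t ht) ht
  refine ⟨(g (∑ i, s i), fun i => lob n f i s), ⟨s, hs, (hnash s hs).2 hQs, rfl, fun _ => rfl⟩, ?_⟩
  rintro ⟨q, qb⟩ ⟨t, ht, hN, hq, hqb⟩
  simp only at hN hq hqb
  have hqb' : qb = fun i => lob n f i t := funext hqb
  subst hqb'
  subst hq
  have hQt := (hnash t ht).1 hN
  have : t = s := by
    by_contra hne
    exact lt_irrefl _ (hstrict t s t s ht hs hQt hQs hne)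
  rw [this]
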